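/- arXiv:0805.1308 — 3 statements merged into one kernel-verified Lean document; each statement's English description precedes it below -/
import Mathlib

section
/- Let Ĵ assign signs {1,-1} to the nearest-neighbor bonds of ℤ³, and assume every plaquette of ℤ³ is frustrated (the product of Ĵ over the 4 boundary bonds of each plaquette is -1). Then for every spin configuration σ : ℤ³ → {1,-1} and every unit cube c of ℤ³, at least 3 of the 12 bonds of c are unsatisfied, i.e., satisfy Ĵ_{ij} σ_i σ_j = -1. -/
/-- The standard unit vector `e_k` of `ℤ³` (sites are functions `Fin 3 → ℤ`). -/
def unitVec (k : Fin 3) : Fin 3 → ℤ := Pi.single k 1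

/-- `e` is a nearest-neighbor bond of `ℤ³`, i.e. an unordered pair `{v, v + e_k}`. -/
def IsBond (e : Sym2 (Fin 3 → ℤ)) : Prop :=
  ∃ (v : Fin 3 → ℤ) (k : Fin 3), e = s(v, v + unitVec k)

/-- The frustration `φ(∂p)` of the plaquette with base point `v` spanned by the
directions `k` and `l`. -/
def plaqFrust (J : Sym2 (Fin 3 → ℤ) → ℤ) (v : Fin 3 → ℤ) (k l : Fin 3) : ℤ :=
  J s(v, v + unitVec k) * J s(v + unitVec l, v + unitVec l + unitVec k) *
    J s(v, v + unitVec l) * J s(v + unitVec k, v + unitVec k + unitVec l)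

/-- The product `σ i * σ j` of spin values over the two endpoints of an
(unordered) bond. -/
def spinProd {V : Type*} (σ : V → ℤ) : Sym2 V → ℤ :=
  Sym2.lift ⟨fun i j => σ i * σ j, fun i j => mul_comm (σ i) (σ j)⟩

/-- The list of the 12 bonds of the unit cube of `ℤ³` at `v`. -/
def cubeBonds (v : Fin 3 → ℤ) : List (Sym2 (Fin 3 → ℤ)) :=
  [s(v, v + unitVec 0), s(v + unitVec 1, v + unitVec 1 + unitVec 0),
    s(v + unitVec 2, v + unitVec 2 + unitVec 0),
    s(v + unitVec 1 + unitVec 2, v + unitVec 1 + unitVec 2 + unitVec 0),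
    s(v, v + unitVec 1), s(v + unitVec 0, v + unitVec 0 + unitVec 1),
    s(v + unitVec 2, v + unitVec 2 + unitVec 1),
    s(v + unitVec 0 + unitVec 2, v + unitVec 0 + unitVec 2 + unitVec 1),
    s(v, v + unitVec 2), s(v + unitVec 0, v + unitVec 0 + unitVec 2),
    s(v + unitVec 1, v + unitVec 1 + unitVec 2),
    s(v + unitVec 0 + unitVec 1, v + unitVec 0 + unitVec 1 + unitVec 2)]

/-- Every bond is either satisfied or unsatisfied. -/
theorem mul_spinProd_eq_one_or {J : Sym2 (Fin 3 → ℤ) → ℤ}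
    (hJ : ∀ e, IsBond e → J e = 1 ∨ J e = -1) {σ : (Fin 3 → ℤ) → ℤ}
    (hσ : ∀ i, σ i = 1 ∨ σ i = -1) (v : Fin 3 → ℤ) (k : Fin 3) :
    J s(v, v + unitVec k) * spinProd σ s(v, v + unitVec k) = 1 ∨
      J s(v, v + unitVec k) * spinProd σ s(v, v + unitVec k) = -1 := by
  have hs : spinProd σ s(v, v + unitVec k) = σ v * σ (v + unitVec k) := rfl
  rw [hs]
  rcases hJ _ ⟨v, k, rfl⟩ with h | h <;> rcases hσ v with h₁ | h₁ <;>
    rcases hσ (v + unitVec k) with h₂ | h₂ <;> simp [h, h₁, h₂]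

/-- A frustrated plaquette has at least one unsatisfied bond. -/
theorem one_le_unsatisfied_of_plaqFrust {J : Sym2 (Fin 3 → ℤ) → ℤ}
    (hJ : ∀ e, IsBond e → J e = 1 ∨ J e = -1) {σ : (Fin 3 → ℤ) → ℤ}
    (hσ : ∀ i, σ i = 1 ∨ σ i = -1) {v : Fin 3 → ℤ} {k l : Fin 3}
    (hfr : plaqFrust J v k l = -1) {u : Sym2 (Fin 3 → ℤ) → ℕ}
    (hu : ∀ e, J e * spinProd σ e = -1 → u e = 1) :
    1 ≤ u s(v, v + unitVec k) + u s(v + unitVec l, v + unitVec l + unitVec k) +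
      u s(v, v + unitVec l) + u s(v + unitVec k, v + unitVec k + unitVec l) := by
  have sq (i) : σ i * σ i = 1 := by rcases hσ i with h | h <;> simp [h]
  have hprod : J s(v, v + unitVec k) * spinProd σ s(v, v + unitVec k) *
      (J s(v + unitVec l, v + unitVec l + unitVec k) *
        spinProd σ s(v + unitVec l, v + unitVec l + unitVec k)) *
      (J s(v, v + unitVec l) * spinProd σ s(v, v + unitVec l)) *
      (J s(v + unitVec k, v + unitVec k + unitVec l) *
        spinProd σ s(v + unitVec k, v + unitVec k + unitVec l)) = -1 := by
    have hs (i j) : spinProd σ s(i, j) = σ i * σ j := rfl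
    calc
      _ = plaqFrust J v k l * (σ v * σ v) * (σ (v + unitVec k) * σ (v + unitVec k)) *
          (σ (v + unitVec l) * σ (v + unitVec l)) *
          (σ (v + unitVec k + unitVec l) * σ (v + unitVec k + unitVec l)) := by
        simp only [hs, plaqFrust, add_right_comm v (unitVec l) (unitVec k)]
        ring
      _ = -1 := by simp only [sq, hfr, mul_one]
  rcases mul_spinProd_eq_one_or hJ hσ v k with h₁ | h₁
  · rcases mul_spinProd_eq_one_or hJ hσ (v + unitVec l) k with h₂ | h₂
    · rcases mul_spinProd_eq_one_or hJ hσ v l with h₃ | h₃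
      · rcases mul_spinProd_eq_one_or hJ hσ (v + unitVec k) l with h₄ | h₄
        · rw [h₁, h₂, h₃, h₄] at hprod
          norm_num at hprod
        · have := hu _ h₄
          omega
      · have := hu _ h₃
        omega
    · have := hu _ h₂
      omega
  · have := hu _ h₁
    omega

/-- If every plaquette of `ℤ³` is frustrated, then for every spin
configuration `σ` and every unit cube, at least 3 of the 12 bonds of the cube are
unsatisfied (`J e * σ i * σ j = -1`). -/
theorem stmt_12 (J : Sym2 (Fin 3 → ℤ) → ℤ) (hJ : ∀ e, IsBond e → J e = 1 ∨ J e = -1)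
    (hfr : ∀ (v : Fin 3 → ℤ) (k l : Fin 3), k ≠ l → plaqFrust J v k l = -1)
    (σ : (Fin 3 → ℤ) → ℤ) (hσ : ∀ i, σ i = 1 ∨ σ i = -1) (v : Fin 3 → ℤ) :
    3 ≤ (cubeBonds v).countP fun e => decide (J e * spinProd σ e = -1) := by
  set u : Sym2 (Fin 3 → ℤ) → ℕ := fun e => if J e * spinProd σ e = -1 then 1 else 0 with hu
  have face (w : Fin 3 → ℤ) (k l : Fin 3) (hkl : k ≠ l) :=
    one_le_unsatisfied_of_plaqFrust hJ hσ (hfr w k l hkl) (u := u) fun e he => if_pos he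
  have hcount : (cubeBonds v).countP (fun e => decide (J e * spinProd σ e = -1)) =
      ((cubeBonds v).map u).sum := by
    induction cubeBonds v with
    | nil => rfl
    | cons e t ih => simp [List.countP_cons, ih, hu, add_comm]
  rw [hcount]
  clear_value u
  have f₁ := face v 0 1 (by decide)
  have f₂ := face v 0 2 (by decide)
  have f₃ := face v 1 2 (by decide)
  have f₄ := face (v + unitVec 2) 0 1 (by decide)
  have f₅ := face (v + unitVec 1) 0 2 (by decide)
  have f₆ := face (v + unitVec 0) 1 2 (by decide)
  simp only [cubeBonds, List.map_cons, List.map_nil, List.sum_cons, List.sum_nil]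
  simp only [add_right_comm v (unitVec 1) (unitVec 0), add_right_comm v (unitVec 2) (unitVec 0),
    add_right_comm v (unitVec 2) (unitVec 1)] at f₁ f₂ f₃ f₄ f₅ f₆ ⊢
  omega
end

section
/- Let Ĵ assign signs {1,-1} to the nearest-neighbor bonds of ℤ³ with every plaquette frustrated, and let σ : ℤ³ → {1,-1} be a spin configuration such that every unit cube of ℤ³ has exactly 3 of its 12 bonds unsatisfied (so the bond-energy sum of each cube is minimized). Then σ is stable against any local spin flip: for every finite nonempty V ⊆ ℤ³, the sum over the boundary bonds (bonds ⟨i,j⟩ with exactly one endpoint in V) of Ĵ_{ij} σ_i σ_j is strictly positive; equivalently, flipping the spins of σ on V strictly increases the energy -J₀ ∑ Ĵ_{ij} σ_i σ_j (for any J₀ > 0), the change being supported on the boundary bonds of V. -/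
/-- The signed bond value `J_{ij} σ_i σ_j` on the bond from `i` to `i + e_k`: it is `1` when the
bond is satisfied and `-1` when it is not. -/
def bondValue (J : Sym2 (Fin 3 → ℤ) → ℤ) (σ : (Fin 3 → ℤ) → ℤ) (i : Fin 3 → ℤ) (k : Fin 3) : ℤ :=
  J s(i, i + unitVec k) * σ i * σ (i + unitVec k)

/-- The indicator function of a finite set of sites. -/
def siteInd (S : Finset (Fin 3 → ℤ)) (i : Fin 3 → ℤ) : ℤ := if i ∈ S then 1 else 0

/-- The bond value on boundary bonds of `S`, and `0` on all other bonds. -/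
def cutValue (J : Sym2 (Fin 3 → ℤ) → ℤ) (σ : (Fin 3 → ℤ) → ℤ) (S : Finset (Fin 3 → ℤ))
    (i : Fin 3 → ℤ) (k : Fin 3) : ℤ :=
  bondValue J σ i k * (siteInd S i - siteInd S (i + unitVec k)) ^ 2

/-- The sum of a bond function over the four bonds of a plaquette. -/
def plaqSum (f : (Fin 3 → ℤ) → Fin 3 → ℤ) (v : Fin 3 → ℤ) (k l : Fin 3) : ℤ :=
  f v k + f (v + unitVec l) k + f v l + f (v + unitVec k) l

lemma bondValue_eq (J : Sym2 (Fin 3 → ℤ) → ℤ) (σ : (Fin 3 → ℤ) → ℤ) (i : Fin 3 → ℤ)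
    (k : Fin 3) :
    J s(i, i + unitVec k) * spinProd σ s(i, i + unitVec k) = bondValue J σ i k := by
  simp [spinProd, bondValue, mul_assoc]

lemma sign_mul_sign {a b : ℤ} (ha : a = 1 ∨ a = -1) (hb : b = 1 ∨ b = -1) :
    a * b = 1 ∨ a * b = -1 := by
  rcases ha with rfl | rfl <;> rcases hb with rfl | rfl <;> simp

lemma bondValue_sign {J : Sym2 (Fin 3 → ℤ) → ℤ} (hJ : ∀ e, IsBond e → J e = 1 ∨ J e = -1)
    {σ : (Fin 3 → ℤ) → ℤ} (hσ : ∀ i, σ i = 1 ∨ σ i = -1) (i : Fin 3 → ℤ) (k : Fin 3) :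
    bondValue J σ i k = 1 ∨ bondValue J σ i k = -1 :=
  sign_mul_sign (sign_mul_sign (hJ _ ⟨i, k, rfl⟩) (hσ _)) (hσ _)

lemma siteInd_eq_zero_or_one (S : Finset (Fin 3 → ℤ)) (i : Fin 3 → ℤ) :
    siteInd S i = 0 ∨ siteInd S i = 1 := by
  unfold siteInd; split_ifs <;> simp

lemma list_sum_sign {α : Type*} (f : α → ℤ) (L : List α) (hf : ∀ a ∈ L, f a = 1 ∨ f a = -1) :
    (L.map f).sum = L.length - 2 * (L.countP fun a => decide (f a = -1)) := by
  induction L with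
  | nil => simp
  | cons a L ih =>
    have h := ih fun b hb => hf b (List.mem_cons_of_mem _ hb)
    rcases hf a List.mem_cons_self with ha | ha <;>
      simp [ha, h] <;> ring

lemma sign_sum_le_two {a b c d : ℤ} (ha : a = 1 ∨ a = -1) (hb : b = 1 ∨ b = -1)
    (hc : c = 1 ∨ c = -1) (hd : d = 1 ∨ d = -1) (h : a * b * c * d = -1) :
    a + b + c + d ≤ 2 := by
  rcases ha with rfl | rfl <;> rcases hb with rfl | rfl <;> rcases hc with rfl | rfl <;>
    rcases hd with rfl | rfl <;> simp_all

/-- A plaquette with a single unsatisfied bond has nonnegative total value on any cut. -/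
lemma cut_plaquette_nonneg {a b c d p q r s : ℤ} (ha : a = 1 ∨ a = -1) (hb : b = 1 ∨ b = -1)
    (hc : c = 1 ∨ c = -1) (hd : d = 1 ∨ d = -1) (h : a + b + c + d = 2)
    (hp : p = 0 ∨ p = 1) (hq : q = 0 ∨ q = 1) (hr : r = 0 ∨ r = 1) (hs : s = 0 ∨ s = 1) :
    0 ≤ a * (p - q) ^ 2 + b * (r - s) ^ 2 + c * (p - r) ^ 2 + d * (q - s) ^ 2 := by
  obtain rfl : d = 2 - a - b - c := by linarith
  rcases hp with rfl | rfl <;> rcases hq with rfl | rfl <;> rcases hr with rfl | rfl <;>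
    rcases hs with rfl | rfl <;> norm_num <;> omega

lemma plaqSum_bondValue_le {J : Sym2 (Fin 3 → ℤ) → ℤ}
    (hJ : ∀ e, IsBond e → J e = 1 ∨ J e = -1)
    {σ : (Fin 3 → ℤ) → ℤ} (hσ : ∀ i, σ i = 1 ∨ σ i = -1) {v : Fin 3 → ℤ} {k l : Fin 3}
    (hfr : plaqFrust J v k l = -1) : plaqSum (bondValue J σ) v k l ≤ 2 := by
  refine sign_sum_le_two (bondValue_sign hJ hσ _ _) (bondValue_sign hJ hσ _ _)
    (bondValue_sign hJ hσ _ _) (bondValue_sign hJ hσ _ _) ?_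
  have hsq : ∀ i, σ i * σ i = 1 := fun i => by rcases hσ i with h | h <;> simp [h]
  rw [← hfr]
  simp only [bondValue, plaqFrust, add_right_comm v (unitVec l) (unitVec k)]
  calc _ = J s(v, v + unitVec k) * J s(v + unitVec l, v + unitVec k + unitVec l) *
        J s(v, v + unitVec l) * J s(v + unitVec k, v + unitVec k + unitVec l) *
        ((σ v * σ v) * (σ (v + unitVec k) * σ (v + unitVec k)) *
          (σ (v + unitVec l) * σ (v + unitVec l)) *
          (σ (v + unitVec k + unitVec l) * σ (v + unitVec k + unitVec l))) := by ring
    _ = _ := by simp only [hsq, mul_one]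

lemma cube_sum {J : Sym2 (Fin 3 → ℤ) → ℤ} (hJ : ∀ e, IsBond e → J e = 1 ∨ J e = -1)
    {σ : (Fin 3 → ℤ) → ℤ} (hσ : ∀ i, σ i = 1 ∨ σ i = -1) {v : Fin 3 → ℤ}
    (hmin : ((cubeBonds v).countP fun e => decide (J e * spinProd σ e = -1)) = 3) :
    ((cubeBonds v).map fun e => J e * spinProd σ e).sum = 6 := by
  rw [list_sum_sign, hmin]
  · simp [cubeBonds]
  · intro e he
    simp only [cubeBonds, List.mem_cons, List.not_mem_nil, or_false] at he
    rcases he with rfl | rfl | rfl | rfl | rfl | rfl | rfl | rfl | rfl | rfl | rfl | rfl <;>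
      exact bondValue_eq J σ _ _ ▸ bondValue_sign hJ hσ _ _

lemma sum_faces_eq (f : (Fin 3 → ℤ) → Fin 3 → ℤ) (g : Sym2 (Fin 3 → ℤ) → ℤ)
    (hg : ∀ i k, g s(i, i + unitVec k) = f i k) (v : Fin 3 → ℤ) :
    plaqSum f v 0 1 + plaqSum f (v + unitVec 2) 0 1 + plaqSum f v 0 2 +
      plaqSum f (v + unitVec 1) 0 2 + plaqSum f v 1 2 + plaqSum f (v + unitVec 0) 1 2 =
      2 * ((cubeBonds v).map g).sum := by
  simp only [cubeBonds, List.map_cons, List.map_nil, List.sum_cons, List.sum_nil, hg, plaqSum]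
  simp only [add_right_comm v (unitVec 2) (unitVec 1), add_right_comm v (unitVec 2) (unitVec 0),
    add_right_comm v (unitVec 1) (unitVec 0)]
  ring

lemma plaqSum_cutValue_nonneg {J : Sym2 (Fin 3 → ℤ) → ℤ}
    (hJ : ∀ e, IsBond e → J e = 1 ∨ J e = -1)
    {σ : (Fin 3 → ℤ) → ℤ} (hσ : ∀ i, σ i = 1 ∨ σ i = -1) (S : Finset (Fin 3 → ℤ))
    {v : Fin 3 → ℤ} {k l : Fin 3} (h : plaqSum (bondValue J σ) v k l = 2) :
    0 ≤ plaqSum (cutValue J σ S) v k l := by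
  have := cut_plaquette_nonneg (bondValue_sign hJ hσ _ _) (bondValue_sign hJ hσ _ _)
    (bondValue_sign hJ hσ _ _) (bondValue_sign hJ hσ _ _) h
    (siteInd_eq_zero_or_one S v) (siteInd_eq_zero_or_one S (v + unitVec k))
    (siteInd_eq_zero_or_one S (v + unitVec l))
    (siteInd_eq_zero_or_one S (v + unitVec k + unitVec l))
  simpa only [plaqSum, cutValue, add_right_comm v (unitVec l) (unitVec k)] using this

lemma exists_corner {S : Finset (Fin 3 → ℤ)} (hS : S.Nonempty) :
    ∃ v ∈ S, (∀ k, v + unitVec k ∉ S) ∧ ∀ k l, v + unitVec k + unitVec l ∉ S := by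
  obtain ⟨v, hv, hmax⟩ := S.exists_max_image (fun v => ∑ i, v i) hS
  have hsum : ∀ k, ∑ i, unitVec k i = 1 := fun k => by simp [unitVec]
  refine ⟨v, hv, fun k hk => ?_, fun k l hk => ?_⟩ <;>
  · have := hmax _ hk
    simp only [Pi.add_apply, Finset.sum_add_distrib, hsum] at this
    omega

lemma plaqSum_cutValue_corner (J : Sym2 (Fin 3 → ℤ) → ℤ) (σ : (Fin 3 → ℤ) → ℤ)
    {S : Finset (Fin 3 → ℤ)} {v : Fin 3 → ℤ} (hv : v ∈ S) (h₁ : ∀ k, v + unitVec k ∉ S)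
    (h₂ : ∀ k l, v + unitVec k + unitVec l ∉ S) (k l : Fin 3) :
    plaqSum (cutValue J σ S) v k l = bondValue J σ v k + bondValue J σ v l := by
  simp [plaqSum, cutValue, siteInd, hv, h₁, h₂]

lemma siteInd_support_finite (S : Finset (Fin 3 → ℤ)) : (Function.support (siteInd S)).Finite :=
  S.finite_toSet.subset fun i hi => by
    by_contra h
    exact hi (if_neg h)

lemma finite_support_shift {f : (Fin 3 → ℤ) → ℤ} (hf : (Function.support f).Finite)
    (w : Fin 3 → ℤ) : (Function.support fun i => f (i + w)).Finite :=
  hf.preimage (f := fun i => i + w) (add_left_injective w).injOn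

lemma finsum_shift (f : (Fin 3 → ℤ) → ℤ) (w : Fin 3 → ℤ) :
    ∑ᶠ i, f (i + w) = ∑ᶠ i, f i :=
  finsum_comp_equiv (Equiv.addRight w)

lemma cutValue_support_finite (J : Sym2 (Fin 3 → ℤ) → ℤ) (σ : (Fin 3 → ℤ) → ℤ)
    (S : Finset (Fin 3 → ℤ)) (k : Fin 3) :
    (Function.support fun i => cutValue J σ S i k).Finite := by
  refine ((siteInd_support_finite S).union
    (finite_support_shift (siteInd_support_finite S) (unitVec k))).subset fun i hi => ?_
  by_contra h
  simp only [Set.mem_union, Function.mem_support, not_or, not_not] at h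
  exact hi (by simp [cutValue, h.1, h.2])

lemma plaqSum_support_finite {f : (Fin 3 → ℤ) → Fin 3 → ℤ}
    (hf : ∀ k, (Function.support fun i => f i k).Finite) (k l : Fin 3) :
    (Function.support fun v => plaqSum f v k l).Finite := by
  have h₁ := (hf k).union (finite_support_shift (hf k) (unitVec l))
  have h₂ := (hf l).union (finite_support_shift (hf l) (unitVec k))
  refine (h₁.union h₂).subset fun i hi => ?_
  by_contra h
  simp only [Set.mem_union, Function.mem_support, not_or, not_not] at h
  exact hi (by simp [plaqSum, h.1.1, h.1.2, h.2.1, h.2.2])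

lemma finsum_plaqSum {f : (Fin 3 → ℤ) → Fin 3 → ℤ}
    (hf : ∀ k, (Function.support fun i => f i k).Finite) (k l : Fin 3) :
    ∑ᶠ v, plaqSum f v k l = 2 * ∑ᶠ v, f v k + 2 * ∑ᶠ v, f v l := by
  have hk := finite_support_shift (hf k) (unitVec l)
  have hl := finite_support_shift (hf l) (unitVec k)
  have h₁ := finsum_add_distrib (hf k) hk
  have h₂ := finsum_add_distrib (hf l) hl
  have h₃ := finsum_add_distrib
    (((hf k).union hk).subset (Function.support_add _ _))
    (((hf l).union hl).subset (Function.support_add _ _))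
  rw [h₁, h₂, finsum_shift (fun i => f i k), finsum_shift (fun i => f i l)] at h₃
  simp only [plaqSum, add_assoc] at h₃ ⊢
  rw [h₃]
  ring

lemma boundary_sum_eq (J : Sym2 (Fin 3 → ℤ) → ℤ) (σ : (Fin 3 → ℤ) → ℤ)
    (S : Finset (Fin 3 → ℤ)) :
    ∑ i ∈ S, ∑ k : Fin 3,
        ((if i + unitVec k ∉ S then J s(i, i + unitVec k) * σ i * σ (i + unitVec k)
            else 0) +
          (if i - unitVec k ∉ S then J s(i - unitVec k, i) * σ (i - unitVec k) * σ i
            else 0)) = ∑ k : Fin 3, ∑ᶠ i, cutValue J σ S i k := by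
  rw [Finset.sum_comm]
  refine Finset.sum_congr rfl fun k _ => ?_
  set out : (Fin 3 → ℤ) → ℤ := fun i =>
    siteInd S i * (1 - siteInd S (i + unitVec k)) * bondValue J σ i k with hout
  set inn : (Fin 3 → ℤ) → ℤ := fun i =>
    siteInd S i * (1 - siteInd S (i - unitVec k)) * bondValue J σ (i - unitVec k) k with hinn
  have hsupp : ∀ g : (Fin 3 → ℤ) → ℤ, (∀ i, i ∉ S → g i = 0) → Function.support g ⊆ S :=
    fun g hg i hi => by
      by_contra h
      exact hi (hg i h)
  have ho := hsupp out fun i hi => by simp [hout, siteInd, hi]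
  have hi := hsupp inn fun i hi => by simp [hinn, siteInd, hi]
  have hcut : ∀ i, cutValue J σ S i k = out i + inn (i + unitVec k) := fun i => by
    simp only [cutValue, hout, hinn, add_sub_cancel_right]
    rcases siteInd_eq_zero_or_one S i with h | h <;>
      rcases siteInd_eq_zero_or_one S (i + unitVec k) with h' | h' <;> simp [h, h']
  simp only [hcut]
  rw [finsum_add_distrib (S.finite_toSet.subset ho)
    (finite_support_shift (S.finite_toSet.subset hi) _), finsum_shift inn,
    finsum_eq_sum_of_support_subset _ ho, finsum_eq_sum_of_support_subset _ hi,
    ← Finset.sum_add_distrib]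
  refine Finset.sum_congr rfl fun i hiS => ?_
  simp only [hout, hinn, siteInd, bondValue, hiS, if_true, sub_add_cancel, one_mul]
  split_ifs <;> simp_all

/-- Suppose every plaquette of `ℤ³` is frustrated and the spin
configuration `σ` minimizes the bond energy of every unit cube (exactly 3 of the 12
bonds of each cube are unsatisfied). Then `σ` is stable against any local spin flip:
for every finite nonempty `V ⊆ ℤ³`, the sum of `J_{ij} σ_i σ_j` over the boundary
bonds of `V` (bonds with exactly one endpoint in `V`) is strictly positive, so
flipping the spins on `V` strictly increases the energy. -/
theorem stmt_13 (J : Sym2 (Fin 3 → ℤ) → ℤ) (hJ : ∀ e, IsBond e → J e = 1 ∨ J e = -1)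
    (hfr : ∀ (v : Fin 3 → ℤ) (k l : Fin 3), k ≠ l → plaqFrust J v k l = -1)
    (σ : (Fin 3 → ℤ) → ℤ) (hσ : ∀ i, σ i = 1 ∨ σ i = -1)
    (hmin : ∀ v : Fin 3 → ℤ,
      ((cubeBonds v).countP fun e => decide (J e * spinProd σ e = -1)) = 3)
    (S : Finset (Fin 3 → ℤ)) (hS : S.Nonempty) :
    0 < ∑ i ∈ S, ∑ k : Fin 3,
        ((if i + unitVec k ∉ S then J s(i, i + unitVec k) * σ i * σ (i + unitVec k)
            else 0) +
          (if i - unitVec k ∉ S then J s(i - unitVec k, i) * σ (i - unitVec k) * σ i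
            else 0)) := by
  have hplaq : ∀ v, plaqSum (bondValue J σ) v 0 1 = 2 ∧ plaqSum (bondValue J σ) v 0 2 = 2 ∧
      plaqSum (bondValue J σ) v 1 2 = 2 := fun v => by
    have h := sum_faces_eq (bondValue J σ) (fun e => J e * spinProd σ e) (bondValue_eq J σ) v
    rw [cube_sum hJ hσ (hmin v)] at h
    have hle := fun w k l (hkl : k ≠ l) => plaqSum_bondValue_le hJ hσ (hfr w k l hkl)
    have h01 := hle v 0 1 (by decide)
    have h01' := hle (v + unitVec 2) 0 1 (by decide)
    have h02 := hle v 0 2 (by decide)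
    have h02' := hle (v + unitVec 1) 0 2 (by decide)
    have h12 := hle v 1 2 (by decide)
    have h12' := hle (v + unitVec 0) 1 2 (by decide)
    omega
  rw [boundary_sum_eq, Fin.sum_univ_three]
  have hf := cutValue_support_finite J σ S
  have hsupp := plaqSum_support_finite hf
  have hnn := fun v => plaqSum_cutValue_nonneg hJ hσ S (hplaq v).1
  have hnn' := fun v => plaqSum_cutValue_nonneg hJ hσ S (hplaq v).2.1
  have hnn'' := fun v => plaqSum_cutValue_nonneg hJ hσ S (hplaq v).2.2
  have e01 := finsum_plaqSum hf 0 1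
  have e02 := finsum_plaqSum hf 0 2
  have e12 := finsum_plaqSum hf 1 2
  obtain ⟨v, hv, h₁, h₂⟩ := exists_corner hS
  have hle := fun k l (h : ∀ w, 0 ≤ plaqSum (cutValue J σ S) w k l) =>
    single_le_finsum v (hsupp k l) h
  have l01 := hle 0 1 hnn
  have l02 := hle 0 2 hnn'
  have l12 := hle 1 2 hnn''
  have n01 := hnn v
  have n02 := hnn' v
  have n12 := hnn'' v
  have c := plaqSum_cutValue_corner J σ hv h₁ h₂
  rw [c] at l01 l02 l12 n01 n02 n12
  have x0 := bondValue_sign hJ hσ v 0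
  have x1 := bondValue_sign hJ hσ v 1
  have x2 := bondValue_sign hJ hσ v 2
  omega
end

section
/- Let E be a finite set and let (J_e)_{e∈E} be independent random signs with P(J_e = +1) = x and P(J_e = -1) = 1-x, where 0 ≤ x ≤ 1. Let P₁, …, P_n be finite subsets of E (plaquette bond sets) such that for each k, P_k contains at least two elements not belonging to P₁ ∪ ⋯ ∪ P_{k-1} (each plaquette shares at most two bonds with the union of the previous ones). Then the probability that all n plaquettes are unfrustrated satisfies Prob[∏_{e∈P_k} J_e = +1 for all k = 1,…,n] ≥ [2x(1-x)]^n. -/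
open Finset in
/-- Resampling the sign of a single bond `a` does not change the expectation under the Bernoulli
product weights. -/
theorem sum_bernoulli_eq_sum_resample {α : Type*} [Fintype α] [DecidableEq α] (x : ℝ) (a : α)
    (G : (α → Bool) → ℝ) :
    ∑ s, G s * ∏ e : α, (if s e then x else 1 - x) =
      ∑ s, (x * G (Function.update s a true) + (1 - x) * G (Function.update s a false)) *
        ∏ e : α, (if s e then x else 1 - x) := by
  have flip_involutive : Function.Involutive
      (fun s : α → Bool => Function.update s a (!s a)) := by
    intro s
    simp
  have two_mul_sum (h : (α → Bool) → ℝ) :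
      2 * ∑ s, h s = ∑ s, (h s + h (Function.update s a (!s a))) := by
    rw [sum_add_distrib, two_mul]
    congr 1
    exact (Equiv.sum_comp flip_involutive.toPerm h).symm
  have weight_eq (s : α → Bool) : ∏ e : α, (if s e then x else 1 - x) =
      (if s a then x else 1 - x) * ∏ e ∈ univ.erase a, (if s e then x else 1 - x) :=
    (mul_prod_erase univ _ (mem_univ a)).symm
  have weight_update_eq (s : α → Bool) (b : Bool) :
      ∏ e ∈ univ.erase a, (if Function.update s a b e then x else 1 - x) =
        ∏ e ∈ univ.erase a, (if s e then x else 1 - x) := by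
    refine prod_congr rfl fun e he => ?_
    rw [Function.update_of_ne (ne_of_mem_erase he)]
  refine mul_left_cancel₀ (two_ne_zero (α := ℝ)) ?_
  rw [two_mul_sum, two_mul_sum]
  refine sum_congr rfl fun s _ => ?_
  simp only [weight_eq, weight_update_eq, Function.update_self, Function.update_idem]
  have update_eq : Function.update s a (s a) = s := Function.update_eq_self a s
  cases h : s a <;> rw [h] at update_eq <;> simp [update_eq] <;> ring

open Finset in
/-- If a nonnegative observable `F` does not depend on two distinct bonds `a, b` of a plaquette
`Q`, then requiring `Q` to be unfrustrated costs at most a factor `2x(1-x)`. -/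
theorem two_mul_mul_sum_le_sum_unfrustrated {α : Type*} [Fintype α] [DecidableEq α]
    (x : ℝ) (hx0 : 0 ≤ x) (hx1 : x ≤ 1) (Q : Finset α) {a b : α} (ha : a ∈ Q) (hb : b ∈ Q)
    (hab : a ≠ b) (F : (α → Bool) → ℝ) (hF : ∀ s, 0 ≤ F s)
    (hFa : ∀ s t, F (Function.update s a t) = F s)
    (hFb : ∀ s t, F (Function.update s b t) = F s) :
    2 * x * (1 - x) * ∑ s, F s * ∏ e : α, (if s e then x else 1 - x) ≤
      ∑ s, (F s * if (∏ e ∈ Q, if s e then (1 : ℤ) else -1) = 1 then 1 else 0) *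
        ∏ e : α, (if s e then x else 1 - x) := by
  have sign_prod_update (s : α → Bool) (t u : Bool) :
      (∏ e ∈ Q, if Function.update (Function.update s a t) b u e then (1 : ℤ) else -1) =
        (if u then 1 else -1) * ((if t then 1 else -1) *
          ∏ e ∈ (Q.erase b).erase a, if s e then (1 : ℤ) else -1) := by
    rw [← mul_prod_erase Q _ hb, ← mul_prod_erase (Q.erase b) _ (mem_erase.2 ⟨hab, ha⟩),
      Function.update_self, Function.update_of_ne hab, Function.update_self]
    congr 2
    refine prod_congr rfl fun e he => ?_
    simp only [mem_erase] at he
    rw [Function.update_of_ne he.2.1, Function.update_of_ne he.1]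
  have sign_prod_eq (R : Finset α) (s : α → Bool) :
      (∏ e ∈ R, if s e then (1 : ℤ) else -1) = 1 ∨
        (∏ e ∈ R, if s e then (1 : ℤ) else -1) = -1 := by
    refine prod_induction _ (fun z : ℤ => z = 1 ∨ z = -1) ?_ (Or.inl rfl) ?_
    · rintro y z (rfl | rfl) (rfl | rfl) <;> simp
    · intro e _
      split_ifs <;> simp
  conv_rhs => rw [sum_bernoulli_eq_sum_resample x b, sum_bernoulli_eq_sum_resample x a]
  rw [mul_sum]
  refine sum_le_sum fun s _ => ?_
  rw [← mul_assoc]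
  refine mul_le_mul_of_nonneg_right ?_ (prod_nonneg fun e _ => by split_ifs <;> linarith)
  simp only [hFa, hFb, sign_prod_update]
  rcases sign_prod_eq ((Q.erase b).erase a) s with h | h <;> rw [h] <;> norm_num
  · nlinarith [mul_nonneg (hF s) (sq_nonneg (2 * x - 1))]
  · nlinarith [hF s]

open Finset in
/-- The lower bound on the probability that all plaquettes are unfrustrated, with the two new
bonds of each plaquette given explicitly. -/
theorem pow_le_sum_unfrustrated {α : Type*} [Fintype α] [DecidableEq α]
    (x : ℝ) (hx0 : 0 ≤ x) (hx1 : x ≤ 1) (n : ℕ) (P : Fin n → Finset α)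
    (hP : ∀ k, ∃ a ∈ P k, ∃ b ∈ P k, a ≠ b ∧ ∀ j < k, a ∉ P j ∧ b ∉ P j) :
    (2 * x * (1 - x)) ^ n ≤
      ∑ s : α → Bool, (if ∀ k, (∏ e ∈ P k, if s e then (1 : ℤ) else -1) = 1 then 1 else 0) *
        ∏ e : α, (if s e then x else 1 - x) := by
  induction n with
  | zero =>
    have total : ∏ _e : α, ∑ t : Bool, (if t then x else 1 - x) =
        ∑ s : α → Bool, ∏ e : α, (if s e then x else 1 - x) :=
      Fintype.prod_sum fun (_ : α) (t : Bool) => if t then x else 1 - x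
    simp at total
    simp [← total]
  | succ n ih =>
    obtain ⟨a, ha, b, hb, hab, hnew⟩ := hP (Fin.last n)
    have sign_prod_update (c : α) (hc : ∀ k : Fin n, c ∉ P k.castSucc) (s : α → Bool) (t : Bool)
        (k : Fin n) :
        (∏ e ∈ P k.castSucc, if Function.update s c t e then (1 : ℤ) else -1) =
          ∏ e ∈ P k.castSucc, if s e then (1 : ℤ) else -1 := by
      refine prod_congr rfl fun e he => ?_
      rw [Function.update_of_ne fun h : e = c => hc k (h ▸ he)]
    have step := two_mul_mul_sum_le_sum_unfrustrated x hx0 hx1 (P (Fin.last n)) ha hb hab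
      (fun s => if ∀ k : Fin n, (∏ e ∈ P k.castSucc, if s e then (1 : ℤ) else -1) = 1
        then 1 else 0)
      (fun s => by positivity)
      (fun s t => by
        simp only [sign_prod_update a fun k => (hnew _ (Fin.castSucc_lt_last k)).1])
      (fun s t => by
        simp only [sign_prod_update b fun k => (hnew _ (Fin.castSucc_lt_last k)).2])
    have prev := ih (fun k => P k.castSucc) fun k => by
      obtain ⟨c, hc, d, hd, hcd, h⟩ := hP k.castSucc
      exact ⟨c, hc, d, hd, hcd, fun j hj => h j.castSucc (Fin.castSucc_lt_castSucc_iff.2 hj)⟩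
    rw [pow_succ']
    refine (mul_le_mul_of_nonneg_left prev ?_).trans (step.trans_eq ?_)
    · exact mul_nonneg (by linarith) (by linarith)
    · refine sum_congr rfl fun s _ => ?_
      simp only [Fin.forall_fin_succ', ite_and, ite_mul, one_mul, zero_mul]


/-- Independent random signs `(J_e)_{e ∈ E}` on a finite set `E`,
each `+1` with probability `x` (modeled by the Bernoulli product weights on sign
vectors `E → Bool`, `true ↔ +1`). If the plaquette bond sets `P 1, …, P n` are such
that each `P k` has at least two bonds not in the union of the previous ones, then
the probability that all plaquettes are unfrustrated (`∏_{e ∈ P k} J_e = +1` for all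
`k`) is at least `(2x(1-x))^n`. -/
theorem stmt_15 {α : Type*} [Fintype α] [DecidableEq α]
    (x : ℝ) (hx0 : 0 ≤ x) (hx1 : x ≤ 1)
    (n : ℕ) (P : Fin n → Finset α)
    (hP : ∀ k : Fin n,
      2 ≤ (P k \ (Finset.univ.filter (fun j => j < k)).biUnion P).card) :
    (2 * x * (1 - x)) ^ n ≤
      ∑ s ∈ Finset.univ.filter
          (fun s : α → Bool => ∀ k, (∏ e ∈ P k, if s e then (1 : ℤ) else -1) = 1),
        ∏ e : α, (if s e then x else 1 - x) := by
  have new_bonds : ∀ k, ∃ a ∈ P k, ∃ b ∈ P k, a ≠ b ∧ ∀ j < k, a ∉ P j ∧ b ∉ P j := by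
    intro k
    obtain ⟨a, ha, b, hb, hab⟩ := Finset.one_lt_card.1 (hP k)
    simp only [Finset.mem_sdiff, Finset.mem_biUnion, Finset.mem_filter, Finset.mem_univ,
      true_and, not_exists, not_and] at ha hb
    exact ⟨a, ha.1, b, hb.1, hab, fun j hj => ⟨ha.2 j hj, hb.2 j hj⟩⟩
  refine (pow_le_sum_unfrustrated x hx0 hx1 n P new_bonds).trans_eq ?_
  simp only [Finset.sum_filter, ite_mul, one_mul, zero_mul]
end
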